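/- Let f, g, h be three irreducible elements of the maximal ideal 𝔪 of R = ℂ⟦x,y⟧, pairwise non-associated, and assume that each of the quotient rings R/(f,g), R/(g,h), R/(h,f) is a finite-dimensional ℂ-vector space. Define u(A,B) = (m(A)·m(B))/I(A,B) ∈ ℝ for non-associated A, B. Then the ultrametric inequality holds: u(f,g) ≤ max(u(f,h), u(g,h)). -/

import Mathlib

local notation "R" => MvPowerSeries (Fin 2) ℂ

/-- The intersection number of two plane curve singularities defined by `f` and `g`. -/
noncomputable def interNum (f g : R) : ℕ :=
  Module.finrank ℂ (R ⧸ Ideal.span {f, g})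

/-- The multiplicity of a plane curve singularity defined by `f`: the largest `n`
with `f ∈ 𝔪 ^ n`. -/
noncomputable def mult (f : R) : ℕ :=
  sSup {n : ℕ | f ∈ (IsLocalRing.maximalIdeal R) ^ n}

/-- The function `u(A,B) = m(A)·m(B) / (A·B)`. -/
noncomputable def uFun (f g : R) : ℝ :=
  ((mult f : ℝ) * mult g) / interNum f g

section

open Polynomial

section Spectral

theorem spectralNorm_algHom_apply {K L E : Type*} [NormedField K] [Field L] [Field E]
    [Algebra K L] [Algebra K E] (σ : L →ₐ[K] E) (x : L) :
    spectralNorm K E (σ x) = spectralNorm K L x := by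
  rw [spectralNorm, spectralNorm, minpoly.algHom_eq σ σ.injective]

variable {K : Type*} [NontriviallyNormedField K] [IsUltrametricDist K] [CompleteSpace K]

/-- The norm of the class of `G` in `K[X]/(P)`, in terms of the value of `G` at a root of `P`. -/
theorem norm_norm_adjoinRoot_mk [CharZero K] {P : K[X]} (hP : Irreducible P) (G : K[X])
    {a : AlgebraicClosure K} (ha : aeval a P = 0) :
    ‖Algebra.norm K (AdjoinRoot.mk P G)‖ =
      spectralNorm K (AlgebraicClosure K) (aeval a G) ^ P.natDegree := by
  have : Fact (Irreducible P) := ⟨hP⟩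
  have : FiniteDimensional K (AdjoinRoot P) := (AdjoinRoot.powerBasis hP.ne_zero).finite
  have hdim : Module.finrank K (AdjoinRoot P) = P.natDegree := by
    rw [(AdjoinRoot.powerBasis hP.ne_zero).finrank, AdjoinRoot.powerBasis_dim]
  let τ : AdjoinRoot P →ₐ[K] AlgebraicClosure K :=
    AdjoinRoot.liftAlgHom P (Algebra.ofId K _) a ha
  have hτ : τ (AdjoinRoot.mk P G) = aeval a G := by
    simp [τ]
    rfl
  rw [← spectralNorm_extends (L := AlgebraicClosure K),
    Algebra.norm_eq_prod_embeddings K (AlgebraicClosure K),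
    ← spectralMulAlgNorm_def, map_prod]
  simp_rw [spectralMulAlgNorm_def, spectralNorm_algHom_apply]
  rw [Finset.prod_const, Finset.card_univ, AlgHom.card, hdim, ← hτ, spectralNorm_algHom_apply]

theorem spectralNorm_aeval_eq_prod {P : K[X]} (hP : P.Monic) (a : AlgebraicClosure K) :
    spectralNorm K (AlgebraicClosure K) (aeval a P) =
      ((P.aroots (AlgebraicClosure K)).map
        fun b => spectralNorm K (AlgebraicClosure K) (a - b)).prod := by
  have h := (IsAlgClosed.splits (P.map (algebraMap K (AlgebraicClosure K)))).eq_prod_roots_of_monic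
    (hP.map _)
  rw [aeval_def, ← eval_map, h, eval_multiset_prod, Multiset.map_map, ← spectralMulAlgNorm_def,
    map_multiset_prod, Multiset.map_map]
  simp [aroots_def, spectralMulAlgNorm_def, Function.comp_def]

/-- If the root `a` is at least as close to `c` as every root of `Q`, then `Q` is at most as large
at `a` as it is at `c`. -/
theorem spectralNorm_aeval_le {Q : K[X]} (hQ : Q.Monic) {a c : AlgebraicClosure K}
    (h : ∀ b ∈ Q.aroots (AlgebraicClosure K), spectralNorm K (AlgebraicClosure K) (a - c) ≤
      spectralNorm K (AlgebraicClosure K) (c - b)) :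
    spectralNorm K (AlgebraicClosure K) (aeval a Q) ≤
      spectralNorm K (AlgebraicClosure K) (aeval c Q) := by
  rw [spectralNorm_aeval_eq_prod hQ, spectralNorm_aeval_eq_prod hQ]
  refine Multiset.prod_map_le_prod_map₀ _ _ (fun _ _ => spectralNorm_nonneg _) fun b hb => ?_
  calc spectralNorm K (AlgebraicClosure K) (a - b)
      = spectralNorm K (AlgebraicClosure K) ((a - c) + (c - b)) := by ring_nf
    _ ≤ max _ _ := isNonarchimedean_spectralNorm _ _
    _ ≤ _ := max_le (h b hb) le_rfl

theorem exists_spectralNorm_aeval_le {P Q H : K[X]} (hP : P.Monic) (hQ : Q.Monic)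
    (hP' : Irreducible P) (hQ' : Irreducible Q) (hH' : Irreducible H) :
    ∃ a b c : AlgebraicClosure K, aeval a P = 0 ∧ aeval b Q = 0 ∧ aeval c H = 0 ∧
      (spectralNorm K (AlgebraicClosure K) (aeval a Q) ≤
          spectralNorm K (AlgebraicClosure K) (aeval c Q) ∨
        spectralNorm K (AlgebraicClosure K) (aeval b P) ≤
          spectralNorm K (AlgebraicClosure K) (aeval c P)) := by
  classical
  obtain ⟨c, hc⟩ := IsAlgClosed.exists_aeval_eq_zero (AlgebraicClosure K) H
    (degree_pos_of_irreducible hH').ne'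
  have closest : ∀ {F : K[X]}, Irreducible F → ∃ a : AlgebraicClosure K, aeval a F = 0 ∧
      ∀ b ∈ F.aroots (AlgebraicClosure K), spectralNorm K (AlgebraicClosure K) (c - a) ≤
        spectralNorm K (AlgebraicClosure K) (c - b) := by
    intro F hF
    obtain ⟨r, hr⟩ := IsAlgClosed.exists_aeval_eq_zero (AlgebraicClosure K) F
      (degree_pos_of_irreducible hF).ne'
    obtain ⟨a, ha, hmin⟩ := (F.aroots (AlgebraicClosure K)).toFinset.exists_min_image
      (fun b => spectralNorm K (AlgebraicClosure K) (c - b))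
      ⟨r, by simp [hF.ne_zero, hr]⟩
    simp only [Multiset.mem_toFinset] at ha hmin
    exact ⟨a, (mem_aroots.1 ha).2, hmin⟩
  obtain ⟨a, ha, hamin⟩ := closest hP'
  obtain ⟨b, hb, hbmin⟩ := closest hQ'
  have hsymm : ∀ x : AlgebraicClosure K, spectralNorm K (AlgebraicClosure K) (x - c) =
      spectralNorm K (AlgebraicClosure K) (c - x) := fun x => by
    rw [← neg_sub, spectralNorm_neg (Algebra.IsAlgebraic.isAlgebraic _)]
  refine ⟨a, b, c, ha, hb, hc, ?_⟩
  rcases le_total (spectralNorm K (AlgebraicClosure K) (c - a))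
    (spectralNorm K (AlgebraicClosure K) (c - b)) with h | h
  · exact .inl (spectralNorm_aeval_le hQ fun d hd => (hsymm a).trans_le (h.trans (hbmin d hd)))
  · exact .inr (spectralNorm_aeval_le hP fun d hd => (hsymm b).trans_le (h.trans (hamin d hd)))

end Spectral

theorem AdjoinRoot.powerBasisAux'_apply {A : Type*} [CommRing A] {P : A[X]} (hP : P.Monic)
    (j : Fin P.natDegree) :
    AdjoinRoot.powerBasisAux' hP j = AdjoinRoot.mk P (X ^ (j : ℕ)) := by
  have := (AdjoinRoot.powerBasis' hP).basis_eq_pow j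
  rw [AdjoinRoot.powerBasis'_gen] at this
  rw [map_pow, AdjoinRoot.mk_X]
  exact this

/-- Base change of the norm from `A[X]/(P)` to `B[X]/(P)`. -/
theorem AdjoinRoot.map_norm_mk {A B : Type*} [CommRing A] [CommRing B] (φ : A →+* B)
    {P : A[X]} (hP : P.Monic) (G : A[X]) :
    φ (Algebra.norm A (AdjoinRoot.mk P G)) =
      Algebra.norm B (AdjoinRoot.mk (P.map φ) (G.map φ)) := by
  rcases subsingleton_or_nontrivial B with hB | hB
  · exact Subsingleton.elim _ _
  have hdeg : (P.map φ).natDegree = P.natDegree := hP.natDegree_map φ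
  rw [Algebra.norm_eq_matrix_det (AdjoinRoot.powerBasisAux' hP),
    Algebra.norm_eq_matrix_det
      ((AdjoinRoot.powerBasisAux' (hP.map φ)).reindex (finCongr hdeg)), RingHom.map_det]
  congr 1
  ext i j
  simp only [RingHom.mapMatrix_apply, Matrix.map_apply, Algebra.leftMulMatrix_eq_repr_mul,
    Module.Basis.reindex_apply, AdjoinRoot.powerBasisAux'_apply, Module.Basis.repr_reindex_apply]
  rw [← map_mul, ← map_mul, AdjoinRoot.powerBasisAux'_repr_apply_to_fun,
    AdjoinRoot.powerBasisAux'_repr_apply_to_fun,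
    AdjoinRoot.modByMonicHom_mk, AdjoinRoot.modByMonicHom_mk]
  rw [← Polynomial.map_X (f := φ), ← Polynomial.map_pow, ← Polynomial.map_mul,
    ← Polynomial.map_modByMonic _ hP, Polynomial.coeff_map]
  simp

/-- The first `n` coefficients of a power series. -/
noncomputable def PowerSeries.coeffsLT (k : Type*) [Field k] (n : ℕ) :
    PowerSeries k →ₗ[k] (Fin n → k) :=
  LinearMap.pi fun i => PowerSeries.coeff (i : ℕ)

theorem PowerSeries.coeffsLT_surjective (k : Type*) [Field k] (n : ℕ) :
    Function.Surjective (PowerSeries.coeffsLT k n) := by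
  intro c
  refine ⟨PowerSeries.mk fun i => if h : i < n then c ⟨i, h⟩ else 0, ?_⟩
  ext i
  simp [coeffsLT]

theorem PowerSeries.ker_coeffsLT (k : Type*) [Field k] (n : ℕ) :
    LinearMap.ker (PowerSeries.coeffsLT k n) =
      (Ideal.span {(PowerSeries.X ^ n : PowerSeries k)}).restrictScalars k := by
  ext f
  rw [LinearMap.mem_ker, Submodule.restrictScalars_mem, Ideal.mem_span_singleton,
    PowerSeries.X_pow_dvd_iff]
  constructor
  · exact fun h m hm => congrFun h ⟨m, hm⟩
  · exact fun h => funext fun i => h i i.2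

theorem associated_X_pow_finrank {k : Type*} [Field k] {a : PowerSeries k} (ha : a ≠ 0) :
    Module.Finite k (PowerSeries k ⧸ Ideal.span {a}) ∧
    Associated a (PowerSeries.X ^ Module.finrank k (PowerSeries k ⧸ Ideal.span {a})) := by
  obtain ⟨n, hn⟩ := IsDiscreteValuationRing.associated_pow_irreducible ha
    (PowerSeries.X_irreducible : Irreducible (PowerSeries.X : PowerSeries k))
  have e : (PowerSeries k ⧸ Ideal.span {a}) ≃ₗ[k] (Fin n → k) :=
    (Ideal.quotientEquivAlgOfEq k
      (Ideal.span_singleton_eq_span_singleton.2 hn)).toLinearEquiv.trans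
    ((Submodule.Quotient.restrictScalarsEquiv k _).symm.trans
      ((Submodule.quotEquivOfEq _ _ (PowerSeries.ker_coeffsLT k n).symm).trans
      ((PowerSeries.coeffsLT k n).quotKerEquivOfSurjective (PowerSeries.coeffsLT_surjective k n))))
  refine ⟨Module.Finite.equiv e.symm, ?_⟩
  rwa [e.finrank_eq, Module.finrank_fin_fun]

/-- The length of `S/(s)` over a one-variable power series ring is the order of the norm of `s`. -/
theorem associated_norm_X_pow_finrank {k S ι : Type*} [Field k] [CommRing S] [IsDomain S]
    [Algebra (PowerSeries k) S] [Algebra k S] [IsScalarTower k (PowerSeries k) S] [Fintype ι]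
    (b : Module.Basis ι (PowerSeries k) S) {s : S} (hs : s ≠ 0) :
    Associated (Algebra.norm (PowerSeries k) s)
      (PowerSeries.X ^ Module.finrank k (S ⧸ Ideal.span {s})) := by
  have h := Ideal.span_singleton_eq_bot.not.2 hs
  have := fun i => (associated_X_pow_finrank (Ideal.smithCoeffs_ne_zero b _ h i)).1
  refine (associated_norm_prod_smith b hs).trans ?_
  rw [Ideal.finrank_quotient_eq_sum k h b, ← Finset.prod_pow_eq_pow_sum]
  exact Associated.prod _ _ _ fun i _ =>
    (associated_X_pow_finrank (Ideal.smithCoeffs_ne_zero b _ h i)).2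

section LaurentSeriesNorm

open LaurentSeries WithZero Valued

theorem LaurentSeries.valued_isNontrivial (k : Type*) [Field k] :
    (Valued.v : Valuation (LaurentSeries k) ℤᵐ⁰).IsNontrivial := by
  obtain ⟨x, hx⟩ := LaurentSeries.valuation_surjective k (WithZero.exp (1 : ℤ))
  refine ⟨x, ?_, ?_⟩
  · simp [hx]
  · rw [hx, ← WithZero.exp_zero]
    simp [-WithZero.exp_zero]

/-- The `X`-adic valuation on Laurent series has rank one. -/
@[reducible] noncomputable def LaurentSeries.rankOne (k : Type*) [Field k] :
    (Valued.v : Valuation (LaurentSeries k) ℤᵐ⁰).RankOne :=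
  have := LaurentSeries.valued_isNontrivial k
  (Valuation.nonempty_rankOne_iff_mulArchimedean.2 inferInstance).some

attribute [local instance] LaurentSeries.rankOne

variable {k : Type*} [Field k]

theorem LaurentSeries.norm_coe_le_one (a : PowerSeries k) :
    ‖algebraMap (PowerSeries k) (LaurentSeries k) a‖ ≤ 1 := by
  rw [Valued.toNormedField.norm_le_one_iff, LaurentSeries.val_le_one_iff_eq_coe]
  exact ⟨a, rfl⟩

theorem LaurentSeries.norm_coe_eq_of_associated {a b : PowerSeries k} (h : Associated a b) :
    ‖algebraMap (PowerSeries k) (LaurentSeries k) a‖ =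
      ‖algebraMap (PowerSeries k) (LaurentSeries k) b‖ := by
  have key : ∀ {a b : PowerSeries k}, a ∣ b → ‖algebraMap (PowerSeries k) (LaurentSeries k) b‖ ≤
      ‖algebraMap (PowerSeries k) (LaurentSeries k) a‖ := by
    rintro a _ ⟨c, rfl⟩
    rw [map_mul, norm_mul]
    exact mul_le_of_le_one_right (norm_nonneg _) (norm_coe_le_one c)
  exact le_antisymm (key h.dvd') (key h.dvd)

theorem LaurentSeries.norm_coe_X_lt_one :
    ‖algebraMap (PowerSeries k) (LaurentSeries k) PowerSeries.X‖ < 1 := by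
  have h := LaurentSeries.valuation_X_pow k 1
  rw [pow_one] at h
  rw [Valued.toNormedField.norm_lt_one_iff]
  refine (show _ = _ from h).trans_lt ?_
  rw [← WithZero.exp_zero, WithZero.exp_lt_exp]
  norm_num

variable [CharZero k]

theorem LaurentSeries.charZero : CharZero (LaurentSeries k) :=
  charZero_of_injective_algebraMap (algebraMap k (LaurentSeries k)).injective

attribute [local instance] LaurentSeries.charZero

theorem norm_X_pow_finrank_eq {P Q : Polynomial (PowerSeries k)} (hP : P.Monic)
    (hP' : Irreducible P) (hPQ : ¬ P ∣ Q) {a : AlgebraicClosure (LaurentSeries k)}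
    (ha : aeval a (P.map (algebraMap (PowerSeries k) (LaurentSeries k))) = 0) :
    ‖algebraMap (PowerSeries k) (LaurentSeries k) PowerSeries.X‖ ^
        Module.finrank k (AdjoinRoot P ⧸ Ideal.span {AdjoinRoot.mk P Q}) =
      spectralNorm (LaurentSeries k) (AlgebraicClosure (LaurentSeries k))
        (aeval a (Q.map (algebraMap (PowerSeries k) (LaurentSeries k)))) ^ P.natDegree := by
  have : IsDomain (AdjoinRoot P) := AdjoinRoot.isDomain_of_prime hP'.prime
  have hne : AdjoinRoot.mk P Q ≠ 0 := by rwa [Ne, AdjoinRoot.mk_eq_zero]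
  have h := LaurentSeries.norm_coe_eq_of_associated
    (associated_norm_X_pow_finrank (AdjoinRoot.powerBasisAux' hP) hne)
  rw [map_pow, norm_pow] at h
  rw [← h, AdjoinRoot.map_norm_mk _ hP, norm_norm_adjoinRoot_mk
    ((hP.irreducible_iff_irreducible_map_fraction_map (K := LaurentSeries k)).1 hP') _ ha,
    hP.natDegree_map]

/-- The ultrametric inequality for the lengths of intersections of Weierstrass polynomials. -/
theorem finrank_mul_natDegree_le {P Q H : Polynomial (PowerSeries k)}
    (hP : P.Monic) (hQ : Q.Monic) (hH : H.Monic) (hP' : Irreducible P) (hQ' : Irreducible Q)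
    (hH' : Irreducible H) (hPQ : ¬ P ∣ Q) (hQP : ¬ Q ∣ P) (hHQ : ¬ H ∣ Q) (hHP : ¬ H ∣ P) :
    Module.finrank k (AdjoinRoot H ⧸ Ideal.span {AdjoinRoot.mk H Q}) * P.natDegree ≤
        Module.finrank k (AdjoinRoot P ⧸ Ideal.span {AdjoinRoot.mk P Q}) * H.natDegree ∨
      Module.finrank k (AdjoinRoot H ⧸ Ideal.span {AdjoinRoot.mk H P}) * Q.natDegree ≤
        Module.finrank k (AdjoinRoot Q ⧸ Ideal.span {AdjoinRoot.mk Q P}) * H.natDegree := by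
  have irr : ∀ {F : Polynomial (PowerSeries k)}, F.Monic → Irreducible F →
      Irreducible (F.map (algebraMap (PowerSeries k) (LaurentSeries k))) := fun hF hF' =>
    hF.irreducible_iff_irreducible_map_fraction_map.1 hF'
  obtain ⟨a, b, c, ha, hb, hc, h⟩ := exists_spectralNorm_aeval_le (hP.map _) (hQ.map _)
    (irr hP hP') (irr hQ hQ') (irr hH hH')
  have hX0 : 0 < ‖algebraMap (PowerSeries k) (LaurentSeries k) PowerSeries.X‖ := by
    rw [norm_pos_iff, Ne, FaithfulSMul.algebraMap_eq_zero_iff]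
    exact PowerSeries.X_ne_zero
  have key : ∀ {s t : ℝ} {m n p r : ℕ}, 0 ≤ s → s ≤ t →
      ‖algebraMap (PowerSeries k) (LaurentSeries k) PowerSeries.X‖ ^ m = s ^ p →
      ‖algebraMap (PowerSeries k) (LaurentSeries k) PowerSeries.X‖ ^ n = t ^ r →
      n * p ≤ m * r := by
    intro s t m n p r hs hst hm hn
    rw [← pow_le_pow_iff_right_of_lt_one₀ hX0 LaurentSeries.norm_coe_X_lt_one, pow_mul, pow_mul,
      hm, hn, ← pow_mul, ← pow_mul, mul_comm p]
    exact pow_le_pow_left₀ hs hst _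
  exact h.imp
    (fun h => key (spectralNorm_nonneg _) h (norm_X_pow_finrank_eq hP hP' hPQ ha)
      (norm_X_pow_finrank_eq hH hH' hHQ hc))
    (fun h => key (spectralNorm_nonneg _) h (norm_X_pow_finrank_eq hQ hQ' hQP hb)
      (norm_X_pow_finrank_eq hH hH' hHP hc))

end LaurentSeriesNorm

section Weierstrass

open IsLocalRing

theorem PowerSeries.IsWeierstrassFactorizationAt.irreducible {A : Type*} [CommRing A] [IsDomain A]
    [IsLocalRing A] {g u : PowerSeries A} {P : Polynomial A}
    (h : g.IsWeierstrassFactorization P u) (hg : Irreducible g) : Irreducible P := by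
  have hP := h.isDistinguishedAt
  have hmap : P.map (residue A) = Polynomial.X ^ P.natDegree := hP.map_eq_X_pow
  have key : ∀ F : Polynomial A, F.Monic → F ∣ P → F.natDegree ≠ 0 →
      ¬ IsUnit (F : PowerSeries A) := by
    intro F hF hFP hdeg
    have hdvd := Polynomial.map_dvd (residue A) hFP
    rw [hmap, dvd_prime_pow Polynomial.prime_X] at hdvd
    obtain ⟨i, -, hi⟩ := hdvd
    have hi := eq_of_monic_of_associated (hF.map _) (monic_X_pow i) hi
    have hi' : i = F.natDegree := by
      rw [← hF.natDegree_map (residue A), hi, natDegree_X_pow]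
    have h0 := congrArg (fun q => q.coeff 0) hi
    simp only [Polynomial.coeff_map, Polynomial.coeff_X_pow, hi', hdeg.symm, if_false] at h0
    rw [PowerSeries.isUnit_iff_constantCoeff, Polynomial.constantCoeff_coe]
    exact (residue_eq_zero_iff _).1 h0
  refine hP.monic.irreducible_iff_natDegree.2 ⟨?_, fun F G hF hG hFG => ?_⟩
  · rintro rfl
    exact hg.not_isUnit (by rw [h.eq_mul]; simpa using h.isUnit)
  · by_contra! hdeg
    have hmul : g = (F : PowerSeries A) * (G * u) := by
      rw [h.eq_mul, ← hFG, Polynomial.coe_mul, mul_assoc]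
    rcases hg.isUnit_or_isUnit hmul with h1 | h1
    · exact key F hF ⟨G, hFG.symm⟩ hdeg.1 h1
    · exact key G hG ⟨F, by rw [mul_comm, hFG]⟩ hdeg.2 (isUnit_of_mul_isUnit_left h1)

theorem PowerSeries.IsWeierstrassFactorizationAt.associated_of_dvd {A : Type*} [CommRing A]
    [IsDomain A] [IsLocalRing A] {f g u v : PowerSeries A} {P Q : Polynomial A}
    (hf : f.IsWeierstrassFactorization P u) (hg : g.IsWeierstrassFactorization Q v)
    (hfi : Irreducible f) (hgi : Irreducible g) (h : P ∣ Q) : Associated f g := by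
  refine hfi.associated_of_dvd hgi ?_
  obtain ⟨G, rfl⟩ := h
  obtain ⟨w, hw⟩ := hf.isUnit
  rw [hf.eq_mul, hg.eq_mul, ← hw, Polynomial.coe_mul, mul_assoc]
  exact mul_dvd_mul_left _ w.coe_dvd

theorem PowerSeries.IsWeierstrassFactorizationAt.finrank_quotient {k A : Type*} [Field k]
    [CommRing A] [Algebra k A] [IsLocalRing A] [IsAdicComplete (maximalIdeal A) A]
    {f g u v : PowerSeries A} {P Q : Polynomial A}
    (hf : f.IsWeierstrassFactorization P u) (hg : g.IsWeierstrassFactorization Q v) :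
    Module.finrank k (PowerSeries A ⧸ Ideal.span {f, g}) =
      Module.finrank k (AdjoinRoot P ⧸ Ideal.span {AdjoinRoot.mk P Q}) := by
  have e₁ : (PowerSeries A ⧸ Ideal.span {f, g}) ≃ₐ[k]
      (PowerSeries A ⧸ Ideal.span {f}) ⧸
        (Ideal.span {g}).map (Ideal.Quotient.mkₐ k (Ideal.span {f})) :=
    (Ideal.quotientEquivAlgOfEq k (Ideal.span_insert f {g})).trans
      (DoubleQuot.quotQuotEquivQuotSupₐ k (Ideal.span {f}) (Ideal.span {g})).symm
  have e₂ : (AdjoinRoot P ⧸ Ideal.span {AdjoinRoot.mk P Q}) ≃ₐ[k]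
      (PowerSeries A ⧸ Ideal.span {f}) ⧸
        (Ideal.span {g}).map (Ideal.Quotient.mkₐ k (Ideal.span {f})) := by
    refine Ideal.quotientEquivAlg _ _ (hf.algEquivQuotient.restrictScalars k) ?_
    rw [Ideal.map_span, Ideal.map_span, Set.image_singleton, Set.image_singleton]
    have h : Ideal.Quotient.mk (Ideal.span {f}) g =
        Ideal.Quotient.mk (Ideal.span {f}) Q * Ideal.Quotient.mk (Ideal.span {f}) v := by
      rw [← map_mul, ← hg.eq_mul]
    rw [Ideal.Quotient.mkₐ_eq_mk, h, Ideal.span_singleton_mul_right_unit (hg.isUnit.map _)]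
    congr 2
  rw [e₁.toLinearEquiv.finrank_eq, e₂.toLinearEquiv.finrank_eq]

theorem PowerSeries.isAdicComplete_maximalIdeal (k : Type*) [Field k] :
    IsAdicComplete (maximalIdeal (PowerSeries k)) (PowerSeries k) := by
  rw [PowerSeries.maximalIdeal_eq_span_X]
  infer_instance

/-- The ultrametric inequality for plane branches, with orders along a transverse line in place of
multiplicities. -/
theorem finrank_mul_order_le {k : Type*} [Field k] [CharZero k]
    {f g h : PowerSeries (PowerSeries k)}
    (hf : Irreducible f) (hg : Irreducible g) (hh : Irreducible h)
    (hfg : ¬ Associated f g) (hgh : ¬ Associated g h) (hhf : ¬ Associated h f)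
    (hf0 : f.map (residue (PowerSeries k)) ≠ 0) (hg0 : g.map (residue (PowerSeries k)) ≠ 0)
    (hh0 : h.map (residue (PowerSeries k)) ≠ 0) :
    Module.finrank k (PowerSeries (PowerSeries k) ⧸ Ideal.span {g, h}) *
          (f.map (residue (PowerSeries k))).order.toNat ≤
        Module.finrank k (PowerSeries (PowerSeries k) ⧸ Ideal.span {f, g}) *
          (h.map (residue (PowerSeries k))).order.toNat ∨
      Module.finrank k (PowerSeries (PowerSeries k) ⧸ Ideal.span {f, h}) *
          (g.map (residue (PowerSeries k))).order.toNat ≤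
        Module.finrank k (PowerSeries (PowerSeries k) ⧸ Ideal.span {f, g}) *
          (h.map (residue (PowerSeries k))).order.toNat := by
  have := PowerSeries.isAdicComplete_maximalIdeal k
  obtain ⟨P, u, hP⟩ := PowerSeries.exists_isWeierstrassFactorization hf0
  obtain ⟨Q, v, hQ⟩ := PowerSeries.exists_isWeierstrassFactorization hg0
  obtain ⟨H, w, hH⟩ := PowerSeries.exists_isWeierstrassFactorization hh0
  have key := finrank_mul_natDegree_le hP.isDistinguishedAt.monic hQ.isDistinguishedAt.monic
    hH.isDistinguishedAt.monic (hP.irreducible hf) (hQ.irreducible hg) (hH.irreducible hh)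
    (fun hd => hfg (hP.associated_of_dvd hQ hf hg hd))
    (fun hd => hfg (hQ.associated_of_dvd hP hg hf hd).symm)
    (fun hd => hgh (hH.associated_of_dvd hQ hh hg hd).symm)
    (fun hd => hhf (hH.associated_of_dvd hP hh hf hd))
  rw [← hH.finrank_quotient hQ, ← hP.finrank_quotient hQ, ← hH.finrank_quotient hP,
    ← hQ.finrank_quotient hP, hP.natDegree_eq_toNat_order_map,
    hQ.natDegree_eq_toNat_order_map, hH.natDegree_eq_toNat_order_map] at key
  rwa [Set.pair_comm h g, Set.pair_comm h f, Set.pair_comm g f] at key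

end Weierstrass

section LeadingForm

open IsLocalRing

variable {k S : Type*} [Field k] [CommRing S] [Algebra k S]

/-- The degree `n` homogenization of the polynomial `p`, evaluated at `(a, b)`. -/
noncomputable def homogeneousEval (a b : S) (n : ℕ) (p : Polynomial k) : S :=
  ∑ i ∈ Finset.range (n + 1), algebraMap k S (p.coeff i) * (a ^ i * b ^ (n - i))

theorem homogeneousEval_zero (a b : S) (n : ℕ) : homogeneousEval a b n (0 : Polynomial k) = 0 := by
  simp [homogeneousEval]

theorem homogeneousEval_X_mul_add (a b : S) (n : ℕ) (p : Polynomial k) {q : Polynomial k}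
    (hq : q.natDegree ≤ n) :
    homogeneousEval a b (n + 1) (X * p + q) =
      homogeneousEval a b n p * a + homogeneousEval a b n q * b := by
  have h1 : ∑ i ∈ Finset.range (n + 2),
      algebraMap k S ((X * p).coeff i) * (a ^ i * b ^ (n + 1 - i)) =
      homogeneousEval a b n p * a := by
    rw [Finset.sum_range_succ', homogeneousEval, Finset.sum_mul]
    simp only [coeff_X_mul, coeff_X_mul_zero, map_zero, zero_mul, add_zero]
    refine Finset.sum_congr rfl fun i _ => ?_
    rw [Nat.add_sub_add_right]
    ring
  have h2 : ∑ i ∈ Finset.range (n + 2), algebraMap k S (q.coeff i) * (a ^ i * b ^ (n + 1 - i)) =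
      homogeneousEval a b n q * b := by
    rw [Finset.sum_range_succ, homogeneousEval, Finset.sum_mul,
      coeff_eq_zero_of_natDegree_lt (Nat.lt_succ_of_le hq), map_zero, zero_mul, add_zero]
    refine Finset.sum_congr rfl fun i hi => ?_
    rw [Nat.succ_sub (Finset.mem_range_succ_iff.1 hi), pow_succ]
    ring
  rw [← h1, ← h2, ← Finset.sum_add_distrib]
  refine Finset.sum_congr rfl fun i _ => ?_
  rw [coeff_add, map_add, add_mul]

/-- Existence of leading forms: an element of `(a, b) ^ n` is a form of degree `n` in `a` and `b`
modulo `(a, b) ^ (n + 1)`. -/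
theorem exists_sub_homogeneousEval_mem {a b : S}
    (hres : ∀ x : S, ∃ c : k, x - algebraMap k S c ∈ Ideal.span {a, b}) (n : ℕ) {f : S}
    (hf : f ∈ Ideal.span {a, b} ^ n) :
    ∃ p : Polynomial k, p.natDegree ≤ n ∧
      f - homogeneousEval a b n p ∈ Ideal.span {a, b} ^ (n + 1) := by
  induction n generalizing f with
  | zero =>
    obtain ⟨c, hc⟩ := hres f
    exact ⟨C c, by simp, by simpa [homogeneousEval] using hc⟩
  | succ n ih =>
    rw [pow_succ] at hf
    nth_rw 2 [Ideal.span_insert] at hf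
    rw [Ideal.mul_sup, Submodule.mem_sup] at hf
    obtain ⟨x, hx, y, hy, rfl⟩ := hf
    obtain ⟨u, hu, rfl⟩ := Ideal.mem_mul_span_singleton.1 hx
    obtain ⟨v, hv, rfl⟩ := Ideal.mem_mul_span_singleton.1 hy
    obtain ⟨p, hp, hup⟩ := ih hu
    obtain ⟨q, hq, hvq⟩ := ih hv
    refine ⟨X * p + q, ?_, ?_⟩
    · refine natDegree_add_le_of_degree_le (natDegree_mul_le.trans ?_) (hq.trans n.le_succ)
      have : (X : k[X]).natDegree ≤ 1 := natDegree_X_le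
      lia
    · rw [homogeneousEval_X_mul_add a b n p hq]
      have ha : a ∈ Ideal.span {a, b} := Ideal.subset_span (by simp)
      have hb : b ∈ Ideal.span {a, b} := Ideal.subset_span (by simp)
      rw [pow_succ]
      convert Ideal.add_mem _ (Ideal.mul_mem_mul hup ha) (Ideal.mul_mem_mul hvq hb) using 1
      ring

variable {L : Type*} [Field L] [Algebra k L]

theorem map_homogeneousEval {a b : S} {s : k} (χ : S →+* PowerSeries L)
    (hχ : ∀ c, χ (algebraMap k S c) = PowerSeries.C (algebraMap k L c))
    (ha : χ a = PowerSeries.C (algebraMap k L s) * PowerSeries.X) (hb : χ b = PowerSeries.X)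
    {n : ℕ} {p : Polynomial k} (hp : p.natDegree ≤ n) :
    χ (homogeneousEval a b n p) =
      PowerSeries.C (algebraMap k L (p.eval s)) * PowerSeries.X ^ n := by
  rw [eval_eq_sum_range' (Nat.lt_succ_of_le hp), homogeneousEval, map_sum, map_sum, map_sum,
    Finset.sum_mul]
  refine Finset.sum_congr rfl fun i hi => ?_
  rw [← pow_mul_pow_sub (PowerSeries.X : PowerSeries L) (Finset.mem_range_succ_iff.1 hi)]
  simp only [map_mul, map_pow, hχ, ha, hb]
  ring

/-- An element of exact order `n` restricts to a series of order `n` along almost all lines. -/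
theorem exists_order_eq {a b : S}
    (hres : ∀ x : S, ∃ c : k, x - algebraMap k S c ∈ Ideal.span {a, b}) {n : ℕ} {f : S}
    (hf : f ∈ Ideal.span {a, b} ^ n) (hf' : f ∉ Ideal.span {a, b} ^ (n + 1)) :
    ∃ p : Polynomial k, p ≠ 0 ∧ ∀ (s : k) (χ : S →+* PowerSeries L),
      (∀ c, χ (algebraMap k S c) = PowerSeries.C (algebraMap k L c)) →
      χ a = PowerSeries.C (algebraMap k L s) * PowerSeries.X → χ b = PowerSeries.X →
      p.eval s ≠ 0 → (χ f).order = n := by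
  obtain ⟨p, hp, hfp⟩ := exists_sub_homogeneousEval_mem hres n hf
  refine ⟨p, ?_, fun s χ hχ ha hb hs => ?_⟩
  · rintro rfl
    rw [homogeneousEval_zero, sub_zero] at hfp
    exact hf' hfp
  have hle : (Ideal.span {a, b}).map χ ≤ Ideal.span {PowerSeries.X} := by
    rw [Ideal.map_span, Set.image_pair, Ideal.span_le]
    rintro _ (rfl | rfl)
    · exact Ideal.mem_span_singleton.2 (by rw [ha]; exact dvd_mul_left _ _)
    · exact Ideal.mem_span_singleton.2 (by rw [hb])
  have hmem : χ (f - homogeneousEval a b n p) ∈ Ideal.span {PowerSeries.X ^ (n + 1)} := by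
    have := Ideal.mem_map_of_mem χ hfp
    rw [Ideal.map_pow] at this
    rw [← Ideal.span_singleton_pow]
    exact Ideal.pow_right_mono hle _ this
  rw [Ideal.mem_span_singleton, map_sub, map_homogeneousEval χ hχ ha hb hp,
    PowerSeries.X_pow_dvd_iff] at hmem
  have hc : ∀ m < n + 1, PowerSeries.coeff m (χ f) =
      PowerSeries.coeff m (PowerSeries.C (algebraMap k L (p.eval s)) * PowerSeries.X ^ n) :=
    fun m hm => sub_eq_zero.1 (by rw [← map_sub]; exact hmem m hm)
  rw [PowerSeries.order_eq_nat]
  refine ⟨?_, fun m hm => ?_⟩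
  · rw [hc n n.lt_succ_self]
    simpa [PowerSeries.coeff_X_pow] using hs
  · rw [hc m (hm.trans n.lt_succ_self)]
    simp [PowerSeries.coeff_X_pow, hm.ne]

end LeadingForm

section Coordinates

open IsLocalRing

variable (k : Type*) [Field k]

/-- The shear `x ↦ x + s y`, `y ↦ y`. -/
noncomputable def shearFun (s : k) : Fin 2 → MvPowerSeries (Fin 2) k :=
  ![MvPowerSeries.X 0 + algebraMap k _ s * MvPowerSeries.X 1, MvPowerSeries.X 1]

theorem hasSubst_shearFun (s : k) : MvPowerSeries.HasSubst (shearFun k s) :=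
  MvPowerSeries.hasSubst_of_constantCoeff_zero fun i => by fin_cases i <;> simp [shearFun]

/-- The shear `x ↦ x + s y`, `y ↦ y` as an endomorphism of `k⟦x, y⟧`. -/
noncomputable def shearHom (s : k) : MvPowerSeries (Fin 2) k →ₐ[k] MvPowerSeries (Fin 2) k :=
  MvPowerSeries.substAlgHom (hasSubst_shearFun k s)

theorem shearHom_X (s : k) (i : Fin 2) : shearHom k s (MvPowerSeries.X i) = shearFun k s i :=
  MvPowerSeries.substAlgHom_X (hasSubst_shearFun k s) i

theorem shearHom_comp (s : k) : (shearHom k s).comp (shearHom k (-s)) = AlgHom.id k _ := by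
  ext1 f
  rw [AlgHom.comp_apply, shearHom, shearHom, MvPowerSeries.substAlgHom_apply,
    MvPowerSeries.substAlgHom_apply,
    MvPowerSeries.subst_comp_subst_apply (hasSubst_shearFun k (-s)) (hasSubst_shearFun k s)]
  have : (fun i => MvPowerSeries.subst (shearFun k s) (shearFun k (-s) i)) =
      (MvPowerSeries.X : Fin 2 → MvPowerSeries (Fin 2) k) := by
    funext i
    rw [← MvPowerSeries.substAlgHom_apply (hasSubst_shearFun k s)]
    change shearHom k s _ = _
    have h0 := shearHom_X k s 0
    have h1 := shearHom_X k s 1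
    fin_cases i
    · simp only [shearFun, Fin.zero_eta, Matrix.cons_val_zero, Matrix.cons_val_one] at h0 h1 ⊢
      rw [map_add, map_mul, AlgHom.commutes, h0, h1, map_neg]
      ring
    · exact h1
  rw [this, MvPowerSeries.subst_self]
  rfl

/-- The shear `x ↦ x + s y`, `y ↦ y` as an automorphism of `k⟦x, y⟧`. -/
noncomputable def shearEquiv (s : k) :
    MvPowerSeries (Fin 2) k ≃ₐ[k] MvPowerSeries (Fin 2) k :=
  AlgEquiv.ofAlgHom (shearHom k s) (shearHom k (-s)) (shearHom_comp k s)
    (by simpa using shearHom_comp k (-s))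

theorem shearEquiv_X (s : k) (i : Fin 2) : shearEquiv k s (MvPowerSeries.X i) = shearFun k s i :=
  shearHom_X k s i

theorem algebraMap_powerSeries_powerSeries (c : k) :
    algebraMap k (PowerSeries (PowerSeries k)) c = PowerSeries.C (PowerSeries.C c) := by
  rw [PowerSeries.algebraMap_apply, PowerSeries.algebraMap_apply, Algebra.algebraMap_self,
    RingHom.id_apply]

/-- The identification of `Fin 2` with `Option Unit` sending `1` to `none`. -/
def finTwoEquivOptionUnit : Fin 2 ≃ Option Unit where
  toFun := ![some (), none]
  invFun o := o.elim 1 fun _ => 0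
  left_inv i := by fin_cases i <;> rfl
  right_inv o := by rcases o with _ | _ <;> rfl

/-- The isomorphism `k⟦x, y⟧ ≃ k⟦x⟧⟦y⟧`. -/
noncomputable def finTwoPowerSeriesEquiv :
    MvPowerSeries (Fin 2) k ≃ₐ[k] PowerSeries (PowerSeries k) :=
  (MvPowerSeries.renameEquiv k finTwoEquivOptionUnit).trans (MvPowerSeries.optionEquivLeft Unit k)

theorem finTwoPowerSeriesEquiv_X_zero :
    finTwoPowerSeriesEquiv k (MvPowerSeries.X 0) = PowerSeries.C PowerSeries.X := by
  change MvPowerSeries.optionEquivLeft Unit k (MvPowerSeries.rename _ _) = _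
  rw [MvPowerSeries.rename_X]
  exact MvPowerSeries.optionEquivLeft_X_some _

theorem finTwoPowerSeriesEquiv_X_one :
    finTwoPowerSeriesEquiv k (MvPowerSeries.X 1) = PowerSeries.X := by
  change MvPowerSeries.optionEquivLeft Unit k (MvPowerSeries.rename _ _) = _
  rw [MvPowerSeries.rename_X]
  exact MvPowerSeries.optionEquivLeft_X_none

theorem exists_sub_algebraMap_mem_span_X (f : MvPowerSeries (Fin 2) k) :
    ∃ c : k, f - algebraMap k _ c ∈
      Ideal.span {(MvPowerSeries.X 0 : MvPowerSeries (Fin 2) k), MvPowerSeries.X 1} := by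
  let φ := finTwoPowerSeriesEquiv k
  obtain ⟨u, hu⟩ := PowerSeries.X_dvd_iff
    (φ := φ f - PowerSeries.C (PowerSeries.constantCoeff (φ f))).2 (by simp)
  obtain ⟨v, hv⟩ := PowerSeries.X_dvd_iff (φ := PowerSeries.constantCoeff (φ f) -
    PowerSeries.C (PowerSeries.constantCoeff (PowerSeries.constantCoeff (φ f)))).2 (by simp)
  refine ⟨PowerSeries.constantCoeff (PowerSeries.constantCoeff (φ f)),
    Ideal.mem_span_pair.2 ⟨φ.symm (PowerSeries.C v), φ.symm u, φ.injective ?_⟩⟩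
  rw [map_add, map_mul, map_mul, φ.apply_symm_apply, φ.apply_symm_apply,
    finTwoPowerSeriesEquiv_X_zero, finTwoPowerSeriesEquiv_X_one, mul_comm u, ← hu, ← map_mul,
    mul_comm v, ← hv, map_sub, map_sub, AlgEquiv.commutes,
    algebraMap_powerSeries_powerSeries]
  ring

theorem maximalIdeal_eq_span_X :
    maximalIdeal (MvPowerSeries (Fin 2) k) =
      Ideal.span {(MvPowerSeries.X 0 : MvPowerSeries (Fin 2) k), MvPowerSeries.X 1} := by
  have hle : Ideal.span {(MvPowerSeries.X 0 : MvPowerSeries (Fin 2) k), MvPowerSeries.X 1} ≤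
      maximalIdeal (MvPowerSeries (Fin 2) k) := by
    rw [Ideal.span_le]
    rintro _ (rfl | rfl) <;>
    · rw [SetLike.mem_coe, mem_maximalIdeal, mem_nonunits_iff,
        MvPowerSeries.isUnit_iff_constantCoeff]
      simp
  refine le_antisymm (fun f hf => ?_) hle
  obtain ⟨c, hc⟩ := exists_sub_algebraMap_mem_span_X k f
  rcases eq_or_ne c 0 with rfl | hc0
  · simpa using hc
  · have := Ideal.sub_mem _ hf (hle hc)
    rw [sub_sub_cancel] at this
    exact absurd ((IsUnit.mk0 c hc0).map (algebraMap k (MvPowerSeries (Fin 2) k))) this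

/-- Coordinates in which `y` is a general linear form. -/
noncomputable def shearedEquiv (s : k) :
    MvPowerSeries (Fin 2) k ≃ₐ[k] PowerSeries (PowerSeries k) :=
  (shearEquiv k s).trans (finTwoPowerSeriesEquiv k)

/-- Restriction to the line `x = s y`. -/
noncomputable def restrictLine (s : k) :
    MvPowerSeries (Fin 2) k →+* PowerSeries (ResidueField (PowerSeries k)) :=
  (PowerSeries.map (residue (PowerSeries k))).comp (shearedEquiv k s)

theorem restrictLine_algebraMap (s c : k) :
    restrictLine k s (algebraMap k _ c) = PowerSeries.C (algebraMap k _ c) := by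
  change PowerSeries.map (residue (PowerSeries k)) (shearedEquiv k s _) = _
  rw [AlgEquiv.commutes, algebraMap_powerSeries_powerSeries, PowerSeries.map_C]
  rfl

theorem restrictLine_X_one (s : k) :
    restrictLine k s (MvPowerSeries.X 1) = PowerSeries.X := by
  change PowerSeries.map (residue (PowerSeries k)) (finTwoPowerSeriesEquiv k (shearEquiv k s _)) = _
  rw [shearEquiv_X, shearFun, Matrix.cons_val_one, Matrix.cons_val_fin_one,
    finTwoPowerSeriesEquiv_X_one, PowerSeries.map_X]

theorem restrictLine_X_zero (s : k) :
    restrictLine k s (MvPowerSeries.X 0) =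
      PowerSeries.C (algebraMap k _ s) * PowerSeries.X := by
  have hX : residue (PowerSeries k) PowerSeries.X = 0 := by
    rw [residue_eq_zero_iff, PowerSeries.maximalIdeal_eq_span_X]
    exact Ideal.mem_span_singleton_self _
  change PowerSeries.map (residue (PowerSeries k)) (finTwoPowerSeriesEquiv k (shearEquiv k s _)) = _
  rw [shearEquiv_X, shearFun, Matrix.cons_val_zero, map_add, map_mul,
    finTwoPowerSeriesEquiv_X_one, finTwoPowerSeriesEquiv_X_zero, AlgEquiv.commutes, map_add,
    map_mul, PowerSeries.map_C, hX, map_zero, zero_add, PowerSeries.map_X]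
  rw [algebraMap_powerSeries_powerSeries, PowerSeries.map_C]
  rfl

end Coordinates

section Multiplicity

open IsLocalRing

theorem exists_mem_pow_notMem_pow_succ {A : Type*} [CommRing A] [IsLocalRing A]
    [IsNoetherianRing A] {f : A} (hf : f ≠ 0) :
    ∃ n, f ∈ maximalIdeal A ^ n ∧ f ∉ maximalIdeal A ^ (n + 1) := by
  by_contra! H
  have hall : ∀ n, f ∈ maximalIdeal A ^ n := fun n => by
    induction n with
    | zero => simp
    | succ n ih => exact H n ih
  have hbot := Ideal.iInf_pow_eq_bot_of_isLocalRing (maximalIdeal A)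
    (maximalIdeal.isMaximal A).ne_top
  exact hf (by simpa [hbot] using (Submodule.mem_iInf _).2 hall)

theorem mult_eq {f : MvPowerSeries (Fin 2) ℂ} {n : ℕ}
    (hn : f ∈ maximalIdeal (MvPowerSeries (Fin 2) ℂ) ^ n)
    (hn' : f ∉ maximalIdeal (MvPowerSeries (Fin 2) ℂ) ^ (n + 1)) : mult f = n :=
  IsGreatest.csSup_eq ⟨hn, fun m hm => by
    by_contra! h
    exact hn' (Ideal.pow_le_pow_right h hm)⟩

theorem exists_order_restrictLine_eq {f : MvPowerSeries (Fin 2) ℂ} (hf : f ≠ 0) :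
    ∃ p : ℂ[X], p ≠ 0 ∧ ∀ s, p.eval s ≠ 0 → (restrictLine ℂ s f).order = mult f := by
  obtain ⟨n, hn, hn'⟩ := exists_mem_pow_notMem_pow_succ hf
  rw [mult_eq hn hn']
  rw [maximalIdeal_eq_span_X] at hn hn'
  obtain ⟨p, hp, H⟩ := exists_order_eq (L := ResidueField (PowerSeries ℂ))
    (exists_sub_algebraMap_mem_span_X ℂ) hn hn'
  exact ⟨p, hp, fun s hs => H s (restrictLine ℂ s) (restrictLine_algebraMap ℂ s)
    (restrictLine_X_zero ℂ s) (restrictLine_X_one ℂ s) hs⟩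

theorem interNum_eq_finrank (φ : MvPowerSeries (Fin 2) ℂ ≃ₐ[ℂ] PowerSeries (PowerSeries ℂ))
    (f g : MvPowerSeries (Fin 2) ℂ) :
    interNum f g = Module.finrank ℂ (PowerSeries (PowerSeries ℂ) ⧸ Ideal.span {φ f, φ g}) :=
  (Ideal.quotientEquivAlg _ _ φ (by
    rw [Ideal.map_span, Set.image_pair]; rfl)).toLinearEquiv.finrank_eq

theorem interNum_comm (f g : MvPowerSeries (Fin 2) ℂ) : interNum f g = interNum g f := by
  rw [interNum, interNum, Set.pair_comm]

theorem interNum_pos {f g : MvPowerSeries (Fin 2) ℂ}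
    (hf : f ∈ maximalIdeal (MvPowerSeries (Fin 2) ℂ))
    (hg : g ∈ maximalIdeal (MvPowerSeries (Fin 2) ℂ))
    (H : FiniteDimensional ℂ (MvPowerSeries (Fin 2) ℂ ⧸ Ideal.span {f, g})) :
    0 < interNum f g := by
  have hle : Ideal.span {f, g} ≤ maximalIdeal (MvPowerSeries (Fin 2) ℂ) := by
    rw [Ideal.span_le]
    rintro _ (rfl | rfl) <;> assumption
  have : Nontrivial (MvPowerSeries (Fin 2) ℂ ⧸ Ideal.span {f, g}) :=
    Ideal.Quotient.nontrivial_iff.2 (ne_top_of_le_ne_top (maximalIdeal.isMaximal _).ne_top hle)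
  exact Module.finrank_pos

theorem interNum_mul_mult_le {f g h : MvPowerSeries (Fin 2) ℂ}
    (hf : Irreducible f) (hg : Irreducible g) (hh : Irreducible h)
    (hfg : ¬ Associated f g) (hgh : ¬ Associated g h) (hhf : ¬ Associated h f) :
    interNum g h * mult f ≤ interNum f g * mult h ∨
      interNum f h * mult g ≤ interNum f g * mult h := by
  obtain ⟨p, hp, Hp⟩ := exists_order_restrictLine_eq hf.ne_zero
  obtain ⟨q, hq, Hq⟩ := exists_order_restrictLine_eq hg.ne_zero
  obtain ⟨r, hr, Hr⟩ := exists_order_restrictLine_eq hh.ne_zero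
  obtain ⟨s, hs⟩ : ∃ s, (p * q * r).eval s ≠ 0 := by
    by_contra! H
    exact mul_ne_zero (mul_ne_zero hp hq) hr (Polynomial.funext (by simpa using H))
  simp only [eval_mul, mul_ne_zero_iff] at hs
  let φ := shearedEquiv ℂ s
  have key {t : MvPowerSeries (Fin 2) ℂ} (ht : (restrictLine ℂ s t).order = mult t) :
      (φ t).map (residue (PowerSeries ℂ)) ≠ 0 ∧
        ((φ t).map (residue (PowerSeries ℂ))).order.toNat = mult t := by
    change restrictLine ℂ s t ≠ 0 ∧ (restrictLine ℂ s t).order.toNat = mult t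
    refine ⟨fun h0 => ?_, by rw [ht, ENat.toNat_natCast]⟩
    rw [h0, PowerSeries.order_zero] at ht
    exact ENat.top_ne_natCast _ ht
  obtain ⟨hf0, hfm⟩ := key (Hp s hs.1.1)
  obtain ⟨hg0, hgm⟩ := key (Hq s hs.1.2)
  obtain ⟨hh0, hhm⟩ := key (Hr s hs.2)
  have hass {a b : MvPowerSeries (Fin 2) ℂ} (hab : ¬ Associated a b) :
      ¬ Associated (φ a) (φ b) := fun H => hab (by simpa using H.map φ.symm)
  rw [interNum_eq_finrank φ, interNum_eq_finrank φ f g, interNum_eq_finrank φ, ← hfm, ← hgm, ← hhm]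
  exact finrank_mul_order_le ((MulEquiv.irreducible_iff φ).2 hf)
    ((MulEquiv.irreducible_iff φ).2 hg) ((MulEquiv.irreducible_iff φ).2 hh)
    (hass hfg) (hass hgh) (hass hhf) hf0 hg0 hh0

end Multiplicity

end

/-- Płoski's theorem, reformulated: `u` satisfies the ultrametric inequality. -/
theorem stmt1 (f g h : R)
    (hf : Irreducible f) (hg : Irreducible g) (hh : Irreducible h)
    (hfm : f ∈ IsLocalRing.maximalIdeal R)
    (hgm : g ∈ IsLocalRing.maximalIdeal R)
    (hhm : h ∈ IsLocalRing.maximalIdeal R)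
    (hfg : ¬ Associated f g) (hgh : ¬ Associated g h) (hhf : ¬ Associated h f)
    (Hfg : FiniteDimensional ℂ (R ⧸ Ideal.span {f, g}))
    (Hgh : FiniteDimensional ℂ (R ⧸ Ideal.span {g, h}))
    (Hhf : FiniteDimensional ℂ (R ⧸ Ideal.span {h, f})) :
    uFun f g ≤ max (uFun f h) (uFun g h) := by
  have hgh0 : (0 : ℝ) < interNum g h := by exact_mod_cast interNum_pos hgm hhm Hgh
  have hfh0 : (0 : ℝ) < interNum f h := by
    rw [interNum_comm]
    exact_mod_cast interNum_pos hhm hfm Hhf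
  have hfg0 : (0 : ℝ) < interNum f g := by exact_mod_cast interNum_pos hfm hgm Hfg
  rcases interNum_mul_mult_le hf hg hh hfg hgh hhf with H | H
  · refine le_max_of_le_right ?_
    have H' : (interNum g h : ℝ) * mult f ≤ interNum f g * mult h := by exact_mod_cast H
    rw [uFun, uFun, div_le_div_iff₀ hfg0 hgh0]
    nlinarith [mul_le_mul_of_nonneg_right H' (Nat.cast_nonneg (α := ℝ) (mult g))]
  · refine le_max_of_le_left ?_
    have H' : (interNum f h : ℝ) * mult g ≤ interNum f g * mult h := by exact_mod_cast H
    rw [uFun, uFun, div_le_div_iff₀ hfg0 hfh0]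
    nlinarith [mul_le_mul_of_nonneg_right H' (Nat.cast_nonneg (α := ℝ) (mult f))]
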